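/- arXiv:2101.04489 — 2 statements merged into one kernel-verified Lean document; each statement's English description precedes it below -/
import Mathlib

section
/- Let n ≥ 1 and f be natural numbers with 1 ≤ f ≤ ⌊(n−1)/3⌋, and let p ∈ [0,1] be the per-message success probability. Then the expected number of replicas replying to the client in a PBFT transaction satisfies E(n, f, p) ≥ p² · n · Σ_{m=0}^{n−2} C(n−2, m) · p^m · (1−p)^(n−2−m) · T(p, 2f, m+1)^(2n+2). -/
open Finset

/-- `binomTail p k n` is the probability that a `Binomial(n, p)` random variable is
at least `k`: `∑_{j=k}^{n} C(n,j) p^j (1-p)^(n-j)`. In the PBFT model it is the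
probability that a node receives at least `k` of `n` messages when each message is
delivered independently with probability `p`. -/
noncomputable def binomTail (p : ℝ) (k n : ℕ) : ℝ :=
  ∑ j ∈ Finset.Icc k n, (n.choose j : ℝ) * p ^ j * (1 - p) ^ (n - j)

/-- The joint probability that, in PBFT with `n` replicas tolerating `f` faults and
per-message delivery probability `p`, `m` of the `n-1` backups receive the
PRE-PREPARE, `k` of the `m+1` participating nodes accept the PREPARE phase (each
needing at least `2f` of `m` distinct PREPARE messages), `j` of the `k` nodes accept
the COMMIT phase (each needing at least `2f` of `k-1` distinct COMMIT messages), and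
`s` of the `j` REPLY messages reach the client. -/
noncomputable def jointProb (n f : ℕ) (p : ℝ) (m k j s : ℕ) : ℝ :=
  (j.choose s : ℝ) * p ^ s * (1 - p) ^ (j - s) *
    ((k.choose j : ℝ) * binomTail p (2 * f) (k - 1) ^ j *
      (1 - binomTail p (2 * f) (k - 1)) ^ (k - j)) *
    (((m + 1).choose k : ℝ) * binomTail p (2 * f) m ^ k *
      (1 - binomTail p (2 * f) m) ^ (m + 1 - k)) *
    ((n - 1).choose m : ℝ) * p ^ m * (1 - p) ^ (n - 1 - m)

/-- `expectedReplies n f p` is the expected number of replicas replying to the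
client, `E[S, J ≥ 2f+1, K ≥ 2f+1, M ≥ 2f+1]`: the sum over `m = 2f, …, n-1`,
`k = 2f+1, …, m+1`, `j = 2f+1, …, k`, `s = 0, …, j` of `s` times the joint
probability of these phase outcomes. -/
noncomputable def expectedReplies (n f : ℕ) (p : ℝ) : ℝ :=
  ∑ m ∈ Finset.Icc (2 * f) (n - 1), ∑ k ∈ Finset.Icc (2 * f + 1) (m + 1),
    ∑ j ∈ Finset.Icc (2 * f + 1) k, ∑ s ∈ Finset.range (j + 1),
      (s : ℝ) * jointProb n f p m k j s

lemma aux_bt_nonneg (p : ℝ) (hp0 : 0 ≤ p) (hp1 : p ≤ 1) (k n : ℕ) : 0 ≤ binomTail p k n := by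
  have h : 0 ≤ 1 - p := by linarith
  unfold binomTail
  exact Finset.sum_nonneg fun j _ => by positivity

lemma aux_sum_one (p : ℝ) (n : ℕ) :
    ∑ j ∈ Finset.range (n + 1), (n.choose j : ℝ) * p ^ j * (1 - p) ^ (n - j) = 1 := by
  have h := add_pow p (1 - p) n
  have h1 : p + (1 - p) = 1 := by ring
  rw [h1, one_pow] at h
  refine Eq.trans ?_ h.symm
  exact Finset.sum_congr rfl fun j _ => by ring

lemma aux_bt_le_one (p : ℝ) (hp0 : 0 ≤ p) (hp1 : p ≤ 1) (k n : ℕ) : binomTail p k n ≤ 1 := by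
  have h : 0 ≤ 1 - p := by linarith
  rw [← aux_sum_one p n]
  unfold binomTail
  apply Finset.sum_le_sum_of_subset_of_nonneg
  · intro j hj
    simp only [Finset.mem_Icc, Finset.mem_range] at *
    omega
  · intro j _ _
    positivity

lemma aux_mean (p : ℝ) (j : ℕ) :
    ∑ s ∈ Finset.range (j + 1), (s : ℝ) * ((j.choose s : ℝ) * p ^ s * (1 - p) ^ (j - s))
      = j * p := by
  cases j with
  | zero => simp
  | succ j =>
    rw [Finset.sum_range_succ']
    have h : ∀ s ∈ Finset.range (j + 1), ((s + 1 : ℕ) : ℝ) *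
        (((j + 1).choose (s + 1) : ℝ) * p ^ (s + 1) * (1 - p) ^ (j + 1 - (s + 1)))
        = ((j + 1 : ℕ) : ℝ) * p * ((j.choose s : ℝ) * p ^ s * (1 - p) ^ (j - s)) := by
      intro s _
      have h1 : ((j + 1 : ℕ) : ℝ) * (j.choose s : ℝ)
          = ((j + 1).choose (s + 1) : ℝ) * ((s + 1 : ℕ) : ℝ) := by
        exact_mod_cast Nat.add_one_mul_choose_eq j s
      rw [Nat.add_sub_add_right, pow_succ]
      linear_combination (-(p ^ s * p * (1 - p) ^ (j - s))) * h1
    rw [Finset.sum_congr rfl h, ← Finset.mul_sum, aux_sum_one]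
    simp

lemma aux_joint_nonneg (n f : ℕ) (p : ℝ) (hp0 : 0 ≤ p) (hp1 : p ≤ 1) (m k j s : ℕ) :
    0 ≤ (s : ℝ) * jointProb n f p m k j s := by
  have h : 0 ≤ 1 - p := by linarith
  have h1 := aux_bt_nonneg p hp0 hp1 (2 * f) (k - 1)
  have h2 := aux_bt_nonneg p hp0 hp1 (2 * f) m
  have h3 : 0 ≤ 1 - binomTail p (2 * f) (k - 1) := by
    linarith [aux_bt_le_one p hp0 hp1 (2 * f) (k - 1)]
  have h4 : 0 ≤ 1 - binomTail p (2 * f) m := by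
    linarith [aux_bt_le_one p hp0 hp1 (2 * f) m]
  unfold jointProb
  positivity

lemma aux_inner (n f : ℕ) (p : ℝ) (hp0 : 0 ≤ p) (hp1 : p ≤ 1) (m : ℕ) (hm : 2 * f ≤ m) :
    ((m + 1 : ℕ) : ℝ) * p * binomTail p (2 * f) m ^ (2 * m + 2) *
      (((n - 1).choose m : ℝ) * p ^ m * (1 - p) ^ (n - 1 - m)) ≤
    ∑ k ∈ Finset.Icc (2 * f + 1) (m + 1),
    ∑ j ∈ Finset.Icc (2 * f + 1) k, ∑ s ∈ Finset.range (j + 1),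
      (s : ℝ) * jointProb n f p m k j s := by
  have e : ((m + 1 : ℕ) : ℝ) * p * binomTail p (2 * f) m ^ (2 * m + 2) *
      (((n - 1).choose m : ℝ) * p ^ m * (1 - p) ^ (n - 1 - m)) =
      ∑ s ∈ Finset.range (m + 1 + 1), (s : ℝ) * jointProb n f p m (m + 1) (m + 1) s := by
    rw [← aux_mean, Finset.sum_mul, Finset.sum_mul]
    refine Finset.sum_congr rfl fun s _ => ?_
    unfold jointProb
    simp only [Nat.add_sub_cancel, Nat.choose_self, Nat.sub_self, pow_zero, Nat.cast_one]
    ring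
  rw [e]
  have nn := aux_joint_nonneg n f p hp0 hp1
  refine le_trans ?_ (Finset.single_le_sum (f := fun k => ∑ j ∈ Finset.Icc (2 * f + 1) k,
    ∑ s ∈ Finset.range (j + 1), (s : ℝ) * jointProb n f p m k j s) (a := m + 1) ?_ ?_)
  · refine Finset.single_le_sum (f := fun j => ∑ s ∈ Finset.range (j + 1),
      (s : ℝ) * jointProb n f p m (m + 1) j s) (a := m + 1) ?_ ?_
    · exact fun j _ => Finset.sum_nonneg fun s _ => nn _ _ _ _
    · simp only [Finset.mem_Icc]; omega
  · exact fun k _ => Finset.sum_nonneg fun j _ => Finset.sum_nonneg fun s _ => nn _ _ _ _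
  · simp only [Finset.mem_Icc]; omega

lemma aux_choose (N m : ℕ) : (N + 2) * N.choose m ≤ (m + 2) * (N + 1).choose (m + 1) := by
  have h1 := Nat.add_one_mul_choose_eq N m
  have h2 : N.choose m ≤ (N + 1).choose (m + 1) := by
    rw [Nat.choose_succ_succ]; omega
  nlinarith

/-- **Proposition 1.** For `1 ≤ f ≤ ⌊(n-1)/3⌋` and per-message success probability
`p ∈ [0,1]`, the expected number of replicas replying to the client satisfies
`E(n,f,p) ≥ p² n ∑_{m=0}^{n-2} C(n-2,m) p^m (1-p)^(n-2-m) T(p,2f,m+1)^(2n+2)`. -/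
theorem expectedReplies_lower_bound (n f : ℕ) (hn : 1 ≤ n) (hf1 : 1 ≤ f)
    (hf : f ≤ (n - 1) / 3) (p : ℝ) (hp0 : 0 ≤ p) (hp1 : p ≤ 1) :
    expectedReplies n f p ≥
      p ^ 2 * n * ∑ m ∈ Finset.range (n - 1),
        ((n - 2).choose m : ℝ) * p ^ m * (1 - p) ^ (n - 2 - m) *
          binomTail p (2 * f) (m + 1) ^ (2 * n + 2) := by
  obtain ⟨N, rfl⟩ : ∃ N, n = N + 2 := ⟨n - 2, by omega⟩
  have hq : 0 ≤ 1 - p := by linarith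
  have hN1 : N + 2 - 1 = N + 1 := by omega
  have hN2 : N + 2 - 2 = N := by omega
  have step : ∀ m ∈ Finset.Icc (2 * f) (N + 1), _ := fun m hm =>
    aux_inner (N + 2) f p hp0 hp1 m (Finset.mem_Icc.mp hm).1
  have hE : _ ≤ expectedReplies (N + 2) f p := Finset.sum_le_sum step
  refine ge_iff_le.mpr (le_trans ?_ hE)
  rw [hN1, hN2]
  set F : ℕ → ℝ := fun m => ((m + 1 : ℕ) : ℝ) * p * binomTail p (2 * f) m ^ (2 * m + 2) *
      (((N + 1).choose m : ℝ) * p ^ m * (1 - p) ^ (N + 1 - m)) with hF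
  have hFn : ∀ m, 0 ≤ F m := by
    intro m
    have := aux_bt_nonneg p hp0 hp1 (2 * f) m
    simp only [hF]
    positivity
  have hF0 : ∀ m, m < 2 * f → F m = 0 := by
    intro m hm
    have : binomTail p (2 * f) m = 0 := by
      unfold binomTail
      rw [Finset.Icc_eq_empty (by omega), Finset.sum_empty]
    simp [hF, this]
  have hsum : ∑ m ∈ Finset.Icc (2 * f) (N + 1), F m = ∑ m ∈ Finset.range (N + 1 + 1), F m := by
    apply Finset.sum_subset
    · intro m hm
      simp only [Finset.mem_Icc, Finset.mem_range] at *
      omega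
    · intro m hm hm'
      simp only [Finset.mem_Icc, Finset.mem_range] at *
      exact hF0 m (by omega)
  rw [hsum, Finset.sum_range_succ' F]
  refine le_trans ?_ (le_add_of_nonneg_right (hFn 0))
  rw [Finset.mul_sum]
  refine Finset.sum_le_sum fun m hm => ?_
  have hm' : m ≤ N := by simpa [Nat.lt_succ_iff] using hm
  have hT0 := aux_bt_nonneg p hp0 hp1 (2 * f) (m + 1)
  have hT1 := aux_bt_le_one p hp0 hp1 (2 * f) (m + 1)
  have hpow : binomTail p (2 * f) (m + 1) ^ (2 * (N + 2) + 2) ≤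
      binomTail p (2 * f) (m + 1) ^ (2 * (m + 1) + 2) :=
    pow_le_pow_of_le_one hT0 hT1 (by omega)
  have hc : ((N + 2 : ℕ) : ℝ) * (N.choose m : ℝ) ≤
      ((m + 1 + 1 : ℕ) : ℝ) * ((N + 1).choose (m + 1) : ℝ) := by
    exact_mod_cast aux_choose N m
  simp only [hF]
  rw [Nat.add_sub_add_right]
  calc _ = (((N + 2 : ℕ) : ℝ) * (N.choose m : ℝ)) *
        binomTail p (2 * f) (m + 1) ^ (2 * (N + 2) + 2) * (p ^ (m + 2) * (1 - p) ^ (N - m)) := by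
        ring
    _ ≤ (((m + 1 + 1 : ℕ) : ℝ) * ((N + 1).choose (m + 1) : ℝ)) *
        binomTail p (2 * f) (m + 1) ^ (2 * (m + 1) + 2) * (p ^ (m + 2) * (1 - p) ^ (N - m)) := by
        gcongr
    _ = _ := by ring
end

section
/- Fix natural numbers n ≥ 1 and f with 0 ≤ f ≤ ⌊(n−1)/3⌋. The expected number of replicas replying to the client, as a function of the per-message success probability, is monotone nondecreasing: for all real p₁, p₂ with 0 < p₁ ≤ p₂ < 1, E(n, f, p₁) ≤ E(n, f, p₂). -/
open Finset

/-- Expectation of `g` under `Binomial(N, q)`. -/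
noncomputable def bExp (q : ℝ) (N : ℕ) (g : ℕ → ℝ) : ℝ :=
  ∑ j ∈ Finset.range (N + 1), (N.choose j : ℝ) * (q ^ j * (1 - q) ^ (N - j) * g j)

theorem bExp_zero (q : ℝ) (g : ℕ → ℝ) : bExp q 0 g = g 0 := by simp [bExp]

theorem bExp_succ (q : ℝ) (N : ℕ) (g : ℕ → ℝ) :
    bExp q (N + 1) g = (1 - q) * bExp q N g + q * bExp q N (fun j => g (j + 1)) := by
  have h := Finset.sum_choose_succ_mul (R := ℝ) (fun i k => q ^ i * (1 - q) ^ k * g i) N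
  unfold bExp
  rw [h, Finset.mul_sum, Finset.mul_sum]
  congr 1
  · apply Finset.sum_congr rfl
    intro j hj
    have : j ≤ N := by simpa [Nat.lt_succ_iff] using hj
    rw [Nat.succ_sub this, pow_succ]
    ring
  · apply Finset.sum_congr rfl
    intro j hj
    rw [pow_succ]
    ring

theorem bExp_const (q : ℝ) (N : ℕ) (c : ℝ) : bExp q N (fun _ => c) = c := by
  induction N with
  | zero => exact bExp_zero _ _
  | succ N ih => rw [bExp_succ, ih]; ring

theorem bExp_le {q : ℝ} (h0 : 0 ≤ q) (h1 : q ≤ 1) (N : ℕ) {g g' : ℕ → ℝ}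
    (h : ∀ j, g j ≤ g' j) : bExp q N g ≤ bExp q N g' := by
  have := sub_nonneg.2 h1
  unfold bExp
  gcongr
  exact h _

theorem bExp_mono_q {q q' : ℝ} (h0 : 0 ≤ q) (hq : q ≤ q') (h1 : q' ≤ 1) (N : ℕ) {g : ℕ → ℝ}
    (hg : Monotone g) : bExp q N g ≤ bExp q' N g := by
  induction N generalizing g with
  | zero => simp [bExp_zero]
  | succ N ih =>
    rw [bExp_succ, bExp_succ]
    have a := ih hg
    have hg' : Monotone (fun j => g (j + 1)) := fun x y hxy => hg (by omega)
    have b := ih hg'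
    have c : bExp q' N g ≤ bExp q' N (fun j => g (j + 1)) :=
      bExp_le (h0.trans hq) h1 N (fun j => hg (Nat.le_succ j))
    nlinarith [mul_le_mul_of_nonneg_left a (sub_nonneg.2 (hq.trans h1)),
      mul_le_mul_of_nonneg_left b h0, mul_nonneg (sub_nonneg.2 hq) (sub_nonneg.2 c)]

theorem bExp_mono_N {q : ℝ} (h0 : 0 ≤ q) (h1 : q ≤ 1) {g : ℕ → ℝ}
    (hg : Monotone g) : Monotone (fun N => bExp q N g) := by
  apply monotone_nat_of_le_succ
  intro N
  rw [bExp_succ]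
  have c : bExp q N g ≤ bExp q N (fun j => g (j + 1)) :=
    bExp_le h0 h1 N (fun j => hg (Nat.le_succ j))
  nlinarith

theorem bExp_nonneg {q : ℝ} (h0 : 0 ≤ q) (h1 : q ≤ 1) (N : ℕ) {g : ℕ → ℝ}
    (h : ∀ j, 0 ≤ g j) : 0 ≤ bExp q N g := by
  have := bExp_le h0 h1 N h
  rwa [bExp_const] at this

/-- truncation below `a` -/
noncomputable def cutB (a : ℕ) (g : ℕ → ℝ) (j : ℕ) : ℝ := if a ≤ j then g j else 0

theorem cutB_nonneg (a : ℕ) {g : ℕ → ℝ} (h : ∀ j, 0 ≤ g j) (j : ℕ) : 0 ≤ cutB a g j := by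
  unfold cutB; split_ifs
  · exact h j
  · exact le_rfl

theorem cutB_le (a : ℕ) {g g' : ℕ → ℝ} (h : ∀ j, g j ≤ g' j) (j : ℕ) :
    cutB a g j ≤ cutB a g' j := by
  unfold cutB; split_ifs
  · exact h j
  · exact le_rfl

theorem cutB_mono (a : ℕ) {g : ℕ → ℝ} (h : ∀ j, 0 ≤ g j) (hg : Monotone g) :
    Monotone (cutB a g) := by
  intro x y hxy
  unfold cutB; split_ifs
  · exact hg hxy
  · omega
  · exact h y
  · exact le_rfl

theorem bExp_cutB (q : ℝ) (a N : ℕ) (g : ℕ → ℝ) : bExp q N (cutB a g) =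
    ∑ j ∈ Finset.Icc a N, (N.choose j : ℝ) * (q ^ j * (1 - q) ^ (N - j) * g j) := by
  have : Finset.Icc a N = (Finset.range (N + 1)).filter (fun j => a ≤ j) := by
    ext j; simp; omega
  rw [this, Finset.sum_filter]
  unfold bExp cutB
  apply Finset.sum_congr rfl
  intro j _
  split_ifs <;> simp

theorem binomTail_eq (p : ℝ) (k n : ℕ) : binomTail p k n = bExp p n (cutB k (fun _ => 1)) := by
  rw [bExp_cutB]
  unfold binomTail
  apply Finset.sum_congr rfl
  intro j _
  ring

theorem cutB_one_mono (k : ℕ) : Monotone (cutB k (fun _ => 1)) :=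
  cutB_mono k (fun _ => zero_le_one) monotone_const

theorem binomTail_nonneg' {p : ℝ} (h0 : 0 ≤ p) (h1 : p ≤ 1) (k n : ℕ) : 0 ≤ binomTail p k n := by
  rw [binomTail_eq]
  exact bExp_nonneg h0 h1 _ (cutB_nonneg k (fun _ => zero_le_one))

theorem binomTail_le_one' {p : ℝ} (h0 : 0 ≤ p) (h1 : p ≤ 1) (k n : ℕ) : binomTail p k n ≤ 1 := by
  rw [binomTail_eq]
  have := bExp_le h0 h1 n (g := cutB k (fun _ => 1)) (g' := fun _ => 1)
    (fun j => by unfold cutB; split_ifs <;> norm_num)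
  rwa [bExp_const] at this

theorem binomTail_mono_n {p : ℝ} (h0 : 0 ≤ p) (h1 : p ≤ 1) (k : ℕ) :
    Monotone (binomTail p k) := by
  intro x y hxy
  rw [binomTail_eq, binomTail_eq]
  exact bExp_mono_N h0 h1 (cutB_one_mono k) hxy

theorem binomTail_mono_p {p q : ℝ} (h0 : 0 ≤ p) (hpq : p ≤ q) (h1 : q ≤ 1) (k n : ℕ) :
    binomTail p k n ≤ binomTail q k n := by
  rw [binomTail_eq, binomTail_eq]
  exact bExp_mono_q h0 hpq h1 n (cutB_one_mono k)

/-- composition of two monotone stages -/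
theorem bExp_stage_mono {t : ℕ → ℝ} {N : ℕ → ℕ} (ht : Monotone t) (h0 : ∀ k, 0 ≤ t k)
    (h1 : ∀ k, t k ≤ 1) (hN : Monotone N) {g : ℕ → ℝ} (hg : Monotone g) :
    Monotone (fun k => bExp (t k) (N k) g) := fun x y hxy =>
  (bExp_mono_q (h0 x) (ht hxy) (h1 y) _ hg).trans (bExp_mono_N (h0 y) (h1 y) hg (hN hxy))

theorem bExp_le_both {q q' : ℝ} (h0 : 0 ≤ q) (hq : q ≤ q') (h1 : q' ≤ 1) (N : ℕ) {g g' : ℕ → ℝ}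
    (hg : Monotone g) (h : ∀ j, g j ≤ g' j) : bExp q N g ≤ bExp q' N g' :=
  (bExp_mono_q h0 hq h1 N hg).trans (bExp_le (h0.trans hq) h1 N h)

noncomputable def stS (p : ℝ) (j : ℕ) : ℝ := bExp p j (fun s => (s : ℝ))
noncomputable def stJ (f : ℕ) (p : ℝ) (k : ℕ) : ℝ :=
  bExp (binomTail p (2 * f) (k - 1)) k (cutB (2 * f + 1) (stS p))
noncomputable def stK (f : ℕ) (p : ℝ) (m : ℕ) : ℝ :=
  bExp (binomTail p (2 * f) m) (m + 1) (cutB (2 * f + 1) (stJ f p))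

theorem expectedReplies_eq (n f : ℕ) (p : ℝ) :
    expectedReplies n f p = bExp p (n - 1) (cutB (2 * f) (stK f p)) := by
  unfold expectedReplies
  rw [bExp_cutB]
  apply Finset.sum_congr rfl
  intro m _
  unfold stK
  rw [bExp_cutB]
  simp only [Finset.mul_sum]
  apply Finset.sum_congr rfl
  intro k _
  unfold stJ
  rw [bExp_cutB]
  simp only [Finset.mul_sum]
  apply Finset.sum_congr rfl
  intro j _
  unfold stS bExp
  simp only [Finset.mul_sum]
  apply Finset.sum_congr rfl
  intro s _
  unfold jointProb
  ring

section
variable {p : ℝ}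

theorem cast_mono' : Monotone (fun s : ℕ => (s : ℝ)) := Nat.mono_cast

theorem stS_mono (h0 : 0 ≤ p) (h1 : p ≤ 1) : Monotone (stS p) := bExp_mono_N h0 h1 cast_mono'

theorem cS_mono (h0 : 0 ≤ p) (h1 : p ≤ 1) (a : ℕ) : Monotone (cutB a (stS p)) :=
  cutB_mono _ (fun _ => bExp_nonneg h0 h1 _ (fun s => Nat.cast_nonneg s)) (stS_mono h0 h1)

theorem cJ_mono (h0 : 0 ≤ p) (h1 : p ≤ 1) (f a : ℕ) : Monotone (cutB a (stJ f p)) := by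
  apply cutB_mono
  · intro k
    exact bExp_nonneg (binomTail_nonneg' h0 h1 _ _) (binomTail_le_one' h0 h1 _ _) _
      (cutB_nonneg _ (fun _ => bExp_nonneg h0 h1 _ (fun s => Nat.cast_nonneg s)))
  · exact bExp_stage_mono (t := fun k => binomTail p (2 * f) (k - 1)) (N := fun k => k)
      (fun x y hxy => binomTail_mono_n h0 h1 _ (by omega))
      (fun k => binomTail_nonneg' h0 h1 _ _) (fun k => binomTail_le_one' h0 h1 _ _)
      (fun x y hxy => hxy) (cS_mono h0 h1 _)

theorem cJ_nonneg (h0 : 0 ≤ p) (h1 : p ≤ 1) (f a k : ℕ) : 0 ≤ cutB a (stJ f p) k :=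
  cutB_nonneg _ (fun _ => bExp_nonneg (binomTail_nonneg' h0 h1 _ _) (binomTail_le_one' h0 h1 _ _) _
      (cutB_nonneg _ (fun _ => bExp_nonneg h0 h1 _ (fun s => Nat.cast_nonneg s)))) _

theorem cK_mono (h0 : 0 ≤ p) (h1 : p ≤ 1) (f a : ℕ) : Monotone (cutB a (stK f p)) := by
  apply cutB_mono
  · intro k
    exact bExp_nonneg (binomTail_nonneg' h0 h1 _ _) (binomTail_le_one' h0 h1 _ _) _
      (cJ_nonneg h0 h1 f _)
  · exact bExp_stage_mono (t := fun m => binomTail p (2 * f) m) (N := fun m => m + 1)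
      (binomTail_mono_n h0 h1 _)
      (fun k => binomTail_nonneg' h0 h1 _ _) (fun k => binomTail_le_one' h0 h1 _ _)
      (fun x y hxy => by simpa using hxy) (cJ_mono h0 h1 f _)
end

/-- **Monotonicity in the success probability.** For fixed `n ≥ 1` and
`0 ≤ f ≤ ⌊(n-1)/3⌋`, the expected number of replicas replying to the client is
monotone nondecreasing in the per-message success probability: for
`0 < p₁ ≤ p₂ < 1` we have `E(n, f, p₁) ≤ E(n, f, p₂)`. -/
theorem expectedReplies_mono_in_p (n f : ℕ) (hn : 1 ≤ n) (hf : f ≤ (n - 1) / 3)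
    (p₁ p₂ : ℝ) (hp₁ : 0 < p₁) (hle : p₁ ≤ p₂) (hp₂ : p₂ < 1) :
    expectedReplies n f p₁ ≤ expectedReplies n f p₂ := by
  have h0 : 0 ≤ p₁ := hp₁.le
  have h1 : p₂ ≤ 1 := hp₂.le
  have h0' : 0 ≤ p₂ := h0.trans hle
  have h1' : p₁ ≤ 1 := hle.trans h1
  rw [expectedReplies_eq, expectedReplies_eq]
  refine bExp_le_both h0 hle h1 _ (cK_mono h0 h1' f _) (cutB_le _ fun m => ?_)
  refine bExp_le_both (binomTail_nonneg' h0 h1' _ _) (binomTail_mono_p h0 hle h1 _ _)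
    (binomTail_le_one' h0' h1 _ _) _ (cJ_mono h0 h1' f _) (cutB_le _ fun k => ?_)
  refine bExp_le_both (binomTail_nonneg' h0 h1' _ _) (binomTail_mono_p h0 hle h1 _ _)
    (binomTail_le_one' h0' h1 _ _) _ (cS_mono h0 h1' _) (cutB_le _ fun j => ?_)
  exact bExp_mono_q h0 hle h1 _ cast_mono'
end
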